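/- arXiv:2601.17932 — 4 statements merged into one kernel-verified Lean document; each statement's English description precedes it below -/
import Mathlib

section
/- Let k and L be positive integers, let σ₀ = 1 and σ₁, …, σ_{L+1} > 0, and let radii 0 < r_{L+1} < r_L < … < r₁ be given. For j = 1, …, L+1 define the interface matrices P_j^{(k)} = (1/((2k+1)σ_j))·[[kσ_{j-1} + (k+1)σ_j, (k+1)(σ_j − σ_{j-1})·r_j^{-(2k+1)}], [k(σ_j − σ_{j-1})·r_j^{2k+1}, (k+1)σ_{j-1} + kσ_j]], and let P^{(k)} = P_{L+1}^{(k)} ··· P₁^{(k)} with entries p₁₁, p₁₂, p₂₁, p₂₂. Then p₂₂ ≠ 0 and |p₂₁| ≤ r₁^{2k+1}·|p₂₂|; equivalently, the contracted generalized polarization tensor M_k := −(2k+1)·p₂₁/p₂₂ satisfies |M_k| ≤ (2k+1)·r₁^{2k+1}. -/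
open Matrix

/-- The interface matrix `P_j^{(k)}` for an interface of radius `rj` between a layer
of conductivity `σp` (outside) and one of conductivity `σc` (inside). -/
noncomputable def interfaceMat (k : ℕ) (σp σc rj : ℝ) : Matrix (Fin 2) (Fin 2) ℝ :=
  ((2 * (k : ℝ) + 1) * σc)⁻¹ •
    !![(k : ℝ) * σp + ((k : ℝ) + 1) * σc,
        ((k : ℝ) + 1) * (σc - σp) * rj ^ (-(2 * (k : ℤ) + 1));
       (k : ℝ) * (σc - σp) * rj ^ (2 * (k : ℤ) + 1),
        ((k : ℝ) + 1) * σp + (k : ℝ) * σc]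

/-- The total matrix `P^{(k)} = P_{L+1}^{(k)} ⋯ P₁^{(k)}` (left-multiplicative order). -/
noncomputable def totalMat (k L : ℕ) (σ rr : ℕ → ℝ) : Matrix (Fin 2) (Fin 2) ℝ :=
  (((List.range (L + 1)).map fun j => interfaceMat k (σ j) (σ (j + 1)) (rr (j + 1))).reverse).prod

/-- The cone of second rows `(x, y)` with `-k R y < (k + 1) x` and `x < R y`, which corresponds to
a positive Dirichlet-to-Neumann map at the interface with `R = r ^ (2k + 1)`. -/
def IsPositiveRow (k : ℕ) (R x y : ℝ) : Prop :=
  x < R * y ∧ 0 < k * (R * y) + (k + 1) * x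

lemma IsPositiveRow.pos {k : ℕ} {R x y : ℝ} (hR : 0 < R) (h : IsPositiveRow k R x y) : 0 < y := by
  obtain ⟨h1, h2⟩ := h
  have hk : (0 : ℝ) ≤ k := k.cast_nonneg
  have : 0 < (2 * (k : ℝ) + 1) * (R * y) := by nlinarith
  exact pos_of_mul_pos_right (pos_of_mul_pos_right this (by positivity)) hR.le

lemma IsPositiveRow.mono {k : ℕ} {R R' x y : ℝ} (hR : 0 < R) (hRR' : R ≤ R')
    (h : IsPositiveRow k R x y) : IsPositiveRow k R' x y := by
  have hy : R * y ≤ R' * y := mul_le_mul_of_nonneg_right hRR' (h.pos hR).le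
  have := mul_le_mul_of_nonneg_left hy (k.cast_nonneg (α := ℝ))
  exact ⟨h.1.trans_le hy, by linarith [h.2]⟩

lemma IsPositiveRow.abs_le {k : ℕ} {R x y : ℝ} (hR : 0 < R) (h : IsPositiveRow k R x y) :
    |x| ≤ R * y := by
  have hy := mul_pos hR (h.pos hR)
  have hk : (0 : ℝ) ≤ k := k.cast_nonneg
  refine _root_.abs_le.2 ⟨?_, h.1.le⟩
  by_contra! hx
  nlinarith [h.2]

/-- Multiplying a matrix on the right by an interface matrix preserves positivity of
its second row. -/
lemma IsPositiveRow.mul_interfaceMat {k : ℕ} {p c r : ℝ} (hp : 0 < p) (hc : 0 < c) (hr : 0 < r)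
    {A : Matrix (Fin 2) (Fin 2) ℝ} (h : IsPositiveRow k (r ^ (2 * k + 1)) (A 1 0) (A 1 1)) :
    IsPositiveRow k (r ^ (2 * k + 1)) ((A * interfaceMat k p c r) 1 0)
      ((A * interfaceMat k p c r) 1 1) := by
  have hR : 0 < r ^ (2 * k + 1) := by positivity
  have hz : r ^ (2 * (k : ℤ) + 1) = r ^ (2 * k + 1) := by
    exact_mod_cast zpow_natCast r (2 * k + 1)
  obtain ⟨h1, h2⟩ := h
  simp only [IsPositiveRow, Matrix.mul_apply, Fin.sum_univ_two, interfaceMat, Matrix.smul_apply,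
    _root_.zpow_neg, hz, smul_eq_mul, Matrix.of_apply, Matrix.cons_val', Matrix.cons_val_zero,
    Matrix.cons_val_one, Matrix.cons_val_fin_one]
  generalize r ^ (2 * k + 1) = R at *
  generalize A 1 0 = x at *
  generalize A 1 1 = y at *
  have hk : (2 * (k : ℝ) + 1) ≠ 0 := by positivity
  constructor
  · rw [← sub_pos]
    have : 0 < p / c * (R * y - x) := mul_pos (by positivity) (by linarith)
    convert this using 1
    field_simp
    ring
  · convert h2 using 1
    field_simp
    ring

lemma totalMat_succ (k L : ℕ) (σ rr : ℕ → ℝ) :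
    totalMat k (L + 1) σ rr =
      totalMat k L (fun j => σ (j + 1)) (fun j => rr (j + 1)) *
        interfaceMat k (σ 0) (σ 1) (rr 1) := by
  simp [totalMat, List.range_succ_eq_map (n := L + 1), Function.comp_def]

lemma isPositiveRow_totalMat (k L : ℕ) (σ rr : ℕ → ℝ) (hσ : ∀ j ≤ L + 1, 0 < σ j)
    (hr : ∀ j, 1 ≤ j → j ≤ L + 1 → 0 < rr j) (hrdec : ∀ j, 1 ≤ j → j ≤ L → rr (j + 1) < rr j)
    (hk : 0 < k) :
    IsPositiveRow k (rr 1 ^ (2 * k + 1)) (totalMat k L σ rr 1 0) (totalMat k L σ rr 1 1) := by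
  induction L generalizing σ rr with
  | zero =>
    have h1 := hr 1 le_rfl le_rfl
    have : totalMat k 0 σ rr = 1 * interfaceMat k (σ 0) (σ 1) (rr 1) := by simp [totalMat]
    rw [this]
    refine IsPositiveRow.mul_interfaceMat (hσ 0 (by omega)) (hσ 1 (by omega)) h1 ?_
    simp only [IsPositiveRow, Matrix.one_apply_eq, Matrix.one_apply_ne one_ne_zero]
    constructor
    · positivity
    · simp only [mul_one, mul_zero, add_zero]
      positivity
  | succ L ih =>
    have h1 := hr 1 le_rfl (by omega)
    have h2 := hr 2 (by omega) (by omega)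
    rw [totalMat_succ]
    refine IsPositiveRow.mul_interfaceMat (hσ 0 (by omega)) (hσ 1 (by omega)) h1 ?_
    refine (ih (fun j => σ (j + 1)) (fun j => rr (j + 1)) (fun j hj => hσ _ (by omega))
      (fun j _ hj => hr _ (by omega) (by omega))
      (fun j _ hj => hrdec _ (by omega) (by omega))).mono (pow_pos h2 _) ?_
    exact pow_le_pow_left₀ h2.le (hrdec 1 le_rfl (by omega)).le _

/-- The entry `p₂₂` of the product of the interface matrices is nonzero, and
`|p₂₁| ≤ r₁^{2k+1} |p₂₂|`; equivalently the CGPT `M_k = -(2k+1) p₂₁/p₂₂` satisfies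
`|M_k| ≤ (2k+1) r₁^{2k+1}`. -/
theorem cgpt_bound (k L : ℕ) (hk : 0 < k) (hL : 0 < L)
    (σ rr : ℕ → ℝ) (hσ0 : σ 0 = 1)
    (hσpos : ∀ j, 1 ≤ j → j ≤ L + 1 → 0 < σ j)
    (hrpos : 0 < rr (L + 1))
    (hrdec : ∀ j, 1 ≤ j → j ≤ L → rr (j + 1) < rr j) :
    totalMat k L σ rr 1 1 ≠ 0 ∧
    |totalMat k L σ rr 1 0| ≤ rr 1 ^ (2 * k + 1) * |totalMat k L σ rr 1 1| ∧
    |(-(2 * (k : ℝ) + 1)) * totalMat k L σ rr 1 0 / totalMat k L σ rr 1 1| ≤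
      (2 * (k : ℝ) + 1) * rr 1 ^ (2 * k + 1) := by
  have hr : ∀ j, 1 ≤ j → j ≤ L + 1 → 0 < rr j := by
    intro j hj hjL
    induction hjL using Nat.decreasingInduction with
    | self => exact hrpos
    | of_succ m hm ih => exact (ih (by omega)).trans (hrdec m hj (by omega))
  have hσ : ∀ j ≤ L + 1, 0 < σ j := by
    intro j hj
    rcases j.eq_zero_or_pos with rfl | h
    · simp [hσ0]
    · exact hσpos j h hj
  have hR : 0 < rr 1 ^ (2 * k + 1) := pow_pos (hr 1 le_rfl (by omega)) _
  have h := isPositiveRow_totalMat k L σ rr hσ hr hrdec hk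
  have hy := h.pos hR
  have hx := h.abs_le hR
  refine ⟨hy.ne', by rwa [abs_of_pos hy], ?_⟩
  have hk' : (0 : ℝ) < 2 * k + 1 := by positivity
  rw [abs_div, abs_mul, abs_neg, abs_of_pos hk', abs_of_pos hy, div_le_iff₀ hy, mul_assoc]
  exact mul_le_mul_of_nonneg_left hx hk'.le
end

section
/- Let N ≥ 0 be an integer, and let ρ, s, r₁ > 0 satisfy r₁·ρ < s. Set q := r₁ρ/s ∈ (0,1). Then for every integer k ≥ N+1 and every M ∈ ℝ with |M| ≤ (2k+1)·r₁^{2k+1}, one has M·ρ^{2k+1} + (2k+1)·s^{2k+1} > 0 and |M·ρ^{2k+1} / (M·ρ^{2k+1} + (2k+1)·s^{2k+1})| ≤ q^{2N+3} / (1 − q^{2N+3}). -/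
/-- A perturbation `A` of relative size at most `Q < 1` keeps `A + D` positive, and the ratio
`A / (A + D)` is bounded by `Q / (1 - Q)`. -/
theorem add_pos_and_abs_div_add_le {A D Q : ℝ} (hD : 0 < D) (hQ : Q < 1) (hA : |A| ≤ D * Q) :
    0 < A + D ∧ |A / (A + D)| ≤ Q / (1 - Q) := by
  have hQ' : 0 < 1 - Q := sub_pos.mpr hQ
  have hlow : D * (1 - Q) ≤ A + D := by linarith [neg_abs_le A]
  have hpos : 0 < A + D := (mul_pos hD hQ').trans_le hlow
  have hQ0 : 0 ≤ D * Q := (abs_nonneg A).trans hA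
  refine ⟨hpos, ?_⟩
  rw [abs_div, abs_of_pos hpos]
  calc |A| / (A + D) ≤ D * Q / (D * (1 - Q)) :=
        div_le_div₀ hQ0 hA (mul_pos hD hQ') hlow
    _ = Q / (1 - Q) := mul_div_mul_left _ _ hD.ne'


/-- Key estimate: for a GPT-vanishing structure of order `N`, the multipole coefficients
of the DtN-map difference are bounded uniformly in `k ≥ N+1` by `q^{2N+3}/(1-q^{2N+3})`
with `q = r₁ρ/s`. -/
theorem multipole_coefficient_bound (N : ℕ) (ρ s r₁ q : ℝ)
    (hρ : 0 < ρ) (hs : 0 < s) (hr₁ : 0 < r₁) (hlt : r₁ * ρ < s)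
    (hq : q = r₁ * ρ / s) :
    ∀ k : ℕ, N + 1 ≤ k → ∀ M : ℝ, |M| ≤ (2 * (k : ℝ) + 1) * r₁ ^ (2 * k + 1) →
      0 < M * ρ ^ (2 * k + 1) + (2 * (k : ℝ) + 1) * s ^ (2 * k + 1) ∧
      |M * ρ ^ (2 * k + 1) /
          (M * ρ ^ (2 * k + 1) + (2 * (k : ℝ) + 1) * s ^ (2 * k + 1))| ≤
        q ^ (2 * N + 3) / (1 - q ^ (2 * N + 3)) := by
  intro k hk M hM
  have hq0 : 0 < q := by rw [hq]; positivity
  have hq1 : q < 1 := by rw [hq]; exact (div_lt_one hs).mpr hlt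
  have hqs : r₁ * ρ = s * q := by rw [hq]; field_simp
  have hpow : q ^ (2 * k + 1) ≤ q ^ (2 * N + 3) :=
    pow_le_pow_of_le_one hq0.le hq1.le (by omega)
  refine add_pos_and_abs_div_add_le (by positivity)
    (pow_lt_one₀ hq0.le hq1 (by omega)) ?_
  rw [abs_mul, abs_of_pos (pow_pos hρ _)]
  calc |M| * ρ ^ (2 * k + 1)
      ≤ (2 * (k : ℝ) + 1) * r₁ ^ (2 * k + 1) * ρ ^ (2 * k + 1) := by gcongr
    _ = (2 * (k : ℝ) + 1) * s ^ (2 * k + 1) * q ^ (2 * k + 1) := by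
        rw [mul_assoc, ← mul_pow, hqs, mul_pow, mul_assoc]
    _ ≤ (2 * (k : ℝ) + 1) * s ^ (2 * k + 1) * q ^ (2 * N + 3) := by gcongr
end

section
/- Let σ₁, σ₂, α, γ be real numbers with 0 < σ₁ < 1, σ₂ > 0, σ₁(1 − σ₂)/(1 − σ₁) < α < σ₁ (in particular 0 < α < 1), γ > 1, and γ > (σ₂ − α)/(1 − α/σ₁). Define l₀ = α(σ₂ + γ/σ₁ − γ − 1)/((1 − α)(γ − α)), l₁ = (σ₂ + αγ/σ₁ − α − γ)/((α − 1)(γ − 1)), and l₂ = γ(σ₂ + α/σ₁ − α − 1)/((γ − α)(γ − 1)). Then l₀ + l₁ + l₂ = 1, α·l₀ + l₁ + γ·l₂ = σ₂, (1/α)·l₀ + l₁ + (1/γ)·l₂ = 1/σ₁, and 0 ≤ l₀, l₁, l₂ ≤ 1. -/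
/-- Solvability of the volume-fraction system for the rank-one laminate made of three
isotropic materials with conductivities `α` (low), `1` (background) and `γ` (high):
the proportions `l₀, l₁, l₂` sum to one, lie in `[0,1]`, and realize the arithmetic
mean `σ₂` and harmonic mean `σ₁`. -/
theorem laminate_volume_fractions (σ₁ σ₂ α γ : ℝ)
    (hσ₁0 : 0 < σ₁) (hσ₁1 : σ₁ < 1) (hσ₂ : 0 < σ₂)
    (hαl : σ₁ * (1 - σ₂) / (1 - σ₁) < α) (hαu : α < σ₁) (hα0 : 0 < α)
    (hγ1 : 1 < γ) (hγ : (σ₂ - α) / (1 - α / σ₁) < γ)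
    (l₀ l₁ l₂ : ℝ)
    (hl₀ : l₀ = α * (σ₂ + γ / σ₁ - γ - 1) / ((1 - α) * (γ - α)))
    (hl₁ : l₁ = (σ₂ + α * γ / σ₁ - α - γ) / ((α - 1) * (γ - 1)))
    (hl₂ : l₂ = γ * (σ₂ + α / σ₁ - α - 1) / ((γ - α) * (γ - 1))) :
    l₀ + l₁ + l₂ = 1 ∧
    α * l₀ + l₁ + γ * l₂ = σ₂ ∧
    (1 / α) * l₀ + l₁ + (1 / γ) * l₂ = 1 / σ₁ ∧
    0 ≤ l₀ ∧ l₀ ≤ 1 ∧ 0 ≤ l₁ ∧ l₁ ≤ 1 ∧ 0 ≤ l₂ ∧ l₂ ≤ 1 := by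
  have hα1 : 0 < 1 - α := by linarith
  have hα1' : α - 1 ≠ 0 := by linarith
  have hγ1' : 0 < γ - 1 := by linarith
  have hγα : 0 < γ - α := by linarith
  have hratio : α / σ₁ < 1 := (div_lt_one hσ₁0).mpr hαu
  have hinv : 0 < 1 / σ₁ - 1 := sub_pos.mpr ((one_lt_div hσ₁0).mpr hσ₁1)
  have num₂ : 0 < σ₂ + α / σ₁ - α - 1 := by
    rw [div_lt_iff₀ (by linarith)] at hαl
    have h : 1 - σ₂ < α * (1 - σ₁) / σ₁ := by
      rw [lt_div_iff₀ hσ₁0]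
      linarith
    have e : α * (1 - σ₁) / σ₁ = α / σ₁ - α := by
      field_simp
    linarith
  have num₁ : σ₂ + α * γ / σ₁ - α - γ < 0 := by
    rw [div_lt_iff₀ (by linarith)] at hγ
    have e : α * γ / σ₁ = γ * (α / σ₁) := by ring
    linarith
  have num₀ : 0 < σ₂ + γ / σ₁ - γ - 1 := by
    have h : 0 < (γ - α) * (1 / σ₁ - 1) := mul_pos hγα hinv
    have e : (γ - α) * (1 / σ₁ - 1) = γ / σ₁ - γ - (α / σ₁ - α) := by ring
    linarith
  have pos₀ : 0 ≤ l₀ := by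
    rw [hl₀]
    positivity
  have pos₁ : 0 ≤ l₁ := by
    rw [hl₁]
    exact div_nonneg_of_nonpos num₁.le (mul_nonpos_of_nonpos_of_nonneg (by linarith) hγ1'.le)
  have pos₂ : 0 ≤ l₂ := by
    rw [hl₂]
    positivity
  have hsum : l₀ + l₁ + l₂ = 1 := by
    rw [hl₀, hl₁, hl₂, ← neg_sub α 1]
    field_simp
    ring
  have harith : α * l₀ + l₁ + γ * l₂ = σ₂ := by
    rw [hl₀, hl₁, hl₂, ← neg_sub α 1]
    field_simp
    ring
  have hharm : (1 / α) * l₀ + l₁ + (1 / γ) * l₂ = 1 / σ₁ := by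
    rw [hl₀, hl₁, hl₂, ← neg_sub α 1]
    field_simp
    ring
  exact ⟨hsum, harith, hharm, pos₀, by linarith, pos₁, by linarith, pos₂, by linarith⟩
end

section
/- Let a < b be real numbers, let ε > 0, let a = s₀ < s₁ < … < s_n = b be a partition with s_{k+1} − s_k ≤ ε for every k, and let u, c : [a, b] → ℝ be integrable functions such that ∫_{s_k}^{s_{k+1}} (u(s) − c(s)) ds = 0 for every k. Let f : [a, b] → ℝ be Lipschitz with constant K. Then |∫_a^b (u(s) − c(s))·f(s) ds| ≤ ε·K·∫_a^b (|u(s)| + |c(s)|) ds. -/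
open MeasureTheory

theorem continuousOn_of_abs_sub_le {f : ℝ → ℝ} {K : ℝ} {t : Set ℝ}
    (hf : ∀ x ∈ t, ∀ y ∈ t, |f x - f y| ≤ K * |x - y|) : ContinuousOn f t := by
  refine (LipschitzOnWith.of_dist_le_mul (K := K.toNNReal) fun x hx y hy => ?_).continuousOn
  rw [Real.dist_eq, Real.dist_eq]
  exact (hf x hx y hy).trans
    (mul_le_mul_of_nonneg_right (Real.le_coe_toNNReal K) (abs_nonneg _))

/-- On a single interval, integrating a mean-zero function against a `K`-Lipschitz function
gains a factor of `K` times any upper bound for the length. -/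
theorem abs_integral_mul_le_of_integral_eq_zero {p q ε K : ℝ} (hpq : p ≤ q) (hε : q - p ≤ ε)
    (hK : 0 ≤ K) {g f : ℝ → ℝ} (hg : IntervalIntegrable g volume p q)
    (hg0 : ∫ x in p..q, g x = 0)
    (hf : ∀ x ∈ Set.Icc p q, ∀ y ∈ Set.Icc p q, |f x - f y| ≤ K * |x - y|) :
    |∫ x in p..q, g x * f x| ≤ ε * K * ∫ x in p..q, |g x| := by
  have hgf : IntervalIntegrable (fun x => g x * f x) volume p q :=
    hg.mul_continuousOn (by rw [Set.uIcc_of_le hpq]; exact continuousOn_of_abs_sub_le hf)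
  have heq : ∫ x in p..q, g x * f x = ∫ x in p..q, (g x * f x - g x * f p) := by
    rw [intervalIntegral.integral_sub hgf (hg.mul_const _),
      intervalIntegral.integral_mul_const, hg0, zero_mul, sub_zero]
  rw [heq, ← intervalIntegral.integral_const_mul, ← Real.norm_eq_abs]
  refine intervalIntegral.norm_integral_le_of_norm_le hpq
    (Filter.Eventually.of_forall fun x hx => ?_) (hg.abs.const_mul _)
  have h := hf x ⟨hx.1.le, hx.2⟩ p ⟨le_rfl, hpq⟩
  rw [abs_of_pos (sub_pos.2 hx.1)] at h
  have hle : |f x - f p| ≤ ε * K := by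
    rw [mul_comm]
    exact h.trans (mul_le_mul_of_nonneg_left (by linarith [hx.2]) hK)
  rw [← mul_sub, Real.norm_eq_abs, abs_mul, mul_comm]
  exact mul_le_mul_of_nonneg_right hle (abs_nonneg _)

/-- Oscillation estimate: if `u − c` has vanishing average over each cell of a partition
of mesh at most `ε` and `f` is `K`-Lipschitz on `[a,b]`, then
`|∫ (u − c) f| ≤ ε K ∫ (|u| + |c|)`. -/
theorem oscillation_estimate (a b : ℝ) (hab : a < b)
    (ε : ℝ) (hε : 0 < ε) (n : ℕ) (s : ℕ → ℝ)
    (hs0 : s 0 = a) (hsn : s n = b)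
    (hinc : ∀ k < n, s k < s (k + 1))
    (hmesh : ∀ k < n, s (k + 1) - s k ≤ ε)
    (u c : ℝ → ℝ)
    (hu : IntervalIntegrable u volume a b)
    (hc : IntervalIntegrable c volume a b)
    (havg : ∀ k < n, (∫ x in (s k)..(s (k + 1)), (u x - c x)) = 0)
    (f : ℝ → ℝ) (K : ℝ)
    (hf : ∀ x ∈ Set.Icc a b, ∀ y ∈ Set.Icc a b, |f x - f y| ≤ K * |x - y|) :
    |∫ x in a..b, (u x - c x) * f x| ≤ ε * K * ∫ x in a..b, (|u x| + |c x|) := by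
  have hK : 0 ≤ K := by
    have h := (abs_nonneg _).trans (hf a ⟨le_rfl, hab.le⟩ b ⟨hab.le, le_rfl⟩)
    exact nonneg_of_mul_nonneg_left h (abs_pos.2 (sub_ne_zero.2 hab.ne))
  have hmono : MonotoneOn s (Set.Icc 0 n) := by
    intro i _ j hj hij
    have hjn := hj.2
    clear hj
    induction j, hij using Nat.le_induction with
    | base => exact le_rfl
    | succ j _ ih => exact (ih (by omega)).trans (hinc j (by omega)).le
  have hmem : ∀ k ≤ n, s k ∈ Set.Icc a b := fun k hk =>
    ⟨hs0 ▸ hmono ⟨le_rfl, n.zero_le⟩ ⟨k.zero_le, hk⟩ k.zero_le,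
      hsn ▸ hmono ⟨k.zero_le, hk⟩ ⟨n.zero_le, le_rfl⟩ hk⟩
  have hcell : ∀ k < n, Set.uIcc (s k) (s (k + 1)) ⊆ Set.uIcc a b := fun k hk => by
    rw [Set.uIcc_of_le hab.le, Set.uIcc_of_le (hinc k hk).le]
    exact Set.Icc_subset_Icc (hmem k hk.le).1 (hmem (k + 1) hk).2
  have hg : IntervalIntegrable (fun x => u x - c x) volume a b := hu.sub hc
  have hgf : IntervalIntegrable (fun x => (u x - c x) * f x) volume a b :=
    hg.mul_continuousOn (by rw [Set.uIcc_of_le hab.le]; exact continuousOn_of_abs_sub_le hf)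
  have hsum : ∀ {φ : ℝ → ℝ}, IntervalIntegrable φ volume a b →
      ∫ x in a..b, φ x = ∑ k ∈ Finset.range n, ∫ x in (s k)..(s (k + 1)), φ x := by
    intro φ hφ
    rw [intervalIntegral.sum_integral_adjacent_intervals
      fun k hk => hφ.mono_set (hcell k hk), hs0, hsn]
  calc |∫ x in a..b, (u x - c x) * f x|
      ≤ ∑ k ∈ Finset.range n, |∫ x in (s k)..(s (k + 1)), (u x - c x) * f x| := by
        rw [hsum hgf]
        exact Finset.abs_sum_le_sum_abs _ _
    _ ≤ ∑ k ∈ Finset.range n, ε * K * ∫ x in (s k)..(s (k + 1)), |u x - c x| := by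
        refine Finset.sum_le_sum fun k hk => ?_
        have hk := Finset.mem_range.1 hk
        have hsub := hcell k hk
        have hle := (hinc k hk).le
        have hsub' := hsub
        rw [Set.uIcc_of_le hab.le, Set.uIcc_of_le hle] at hsub'
        exact abs_integral_mul_le_of_integral_eq_zero hle (hmesh k hk) hK
          (hg.mono_set hsub) (havg k hk) fun x hx y hy => hf x (hsub' hx) y (hsub' hy)
    _ = ε * K * ∫ x in a..b, |u x - c x| := by rw [← Finset.mul_sum, ← hsum hg.abs]
    _ ≤ ε * K * ∫ x in a..b, (|u x| + |c x|) :=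
        mul_le_mul_of_nonneg_left
          (intervalIntegral.integral_mono_on hab.le hg.abs (hu.abs.add hc.abs)
            fun x _ => abs_sub _ _) (mul_nonneg hε.le hK)
end
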